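/- arXiv:1103.3086 — 2 statements merged into one kernel-verified Lean document; each statement's English description precedes it below -/
import Mathlib

section
/- For every integer d ≥ 1, all zeros of the Gonchar polynomial G(d;z) = [(z−1)^d − z − 1]·z^{d−1} + (z−1)^d in ℂ are simple; that is, G(d;z) has 2d−1 distinct complex zeros (equivalently, G(d;z) is squarefree, having no common zero with its derivative). -/
/-- The Gonchar polynomial `G(d;z) = [(z−1)^d − z − 1]·z^{d−1} + (z−1)^d`
as a function `ℂ → ℂ`. -/
noncomputable def goncharFun (d : ℕ) : ℂ → ℂ := fun z =>
  ((z - 1) ^ d - z - 1) * z ^ (d - 1) + (z - 1) ^ d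

open Polynomial in
/-- The Gonchar polynomial as a polynomial over `ℂ`. -/
noncomputable def goncharPoly (d : ℕ) : ℂ[X] :=
  ((X - 1) ^ d - X - 1) * X ^ (d - 1) + (X - 1) ^ d

open Polynomial in
theorem eval_goncharPoly (d : ℕ) (z : ℂ) : (goncharPoly d).eval z = goncharFun d z := by
  simp [goncharPoly, goncharFun]

open Polynomial in
theorem eval_derivative_goncharPoly (d : ℕ) (z : ℂ) :
    (derivative (goncharPoly d)).eval z = deriv (goncharFun d) z := by
  have h : goncharFun d = fun z => (goncharPoly d).eval z :=
    funext fun z => (eval_goncharPoly d z).symm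
  rw [h, Polynomial.deriv]

open Polynomial in
theorem natDegree_goncharPoly (n : ℕ) : (goncharPoly (n + 2)).natDegree = 2 * n + 3 := by
  have h : goncharPoly (n + 2) =
      (X - 1) ^ (n + 2) * (X ^ (n + 1) + 1) - (X ^ (n + 2) + X ^ (n + 1)) := by
    simp only [goncharPoly, show n + 2 - 1 = n + 1 from rfl]
    ring
  have h₁ : ((X - 1 : ℂ[X]) ^ (n + 2) * (X ^ (n + 1) + 1)).natDegree = 2 * n + 3 := by
    rw [← C_1, ((monic_X_sub_C (1 : ℂ)).pow _).natDegree_mul (monic_X_pow_add_C _ (by lia)),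
      (monic_X_sub_C (1 : ℂ)).natDegree_pow, natDegree_X_sub_C, natDegree_X_pow_add_C]
    lia
  have h₂ : (X ^ (n + 2) + X ^ (n + 1) : ℂ[X]).natDegree ≤ n + 2 := by compute_degree!
  rw [h, natDegree_sub_eq_left_of_natDegree_lt (by lia), h₁]

/-- A non-unit integer has valuation less than one for some valuation of `K`. -/
theorem exists_valuationSubring_intCast_lt_one {K : Type*} [Field K] [CharZero K] {a : ℤ}
    (ha : ¬IsUnit a) : ∃ V : ValuationSubring K, V.valuation (a : K) < 1 := by
  let R : Subring K := (Int.castRingHom K).range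
  let x : R := ⟨a, a, rfl⟩
  have hx : Ideal.span {x} ≠ ⊤ := by
    rw [Ne, Ideal.span_singleton_eq_top]
    intro hu
    obtain ⟨⟨_, b, rfl⟩, hb⟩ := isUnit_iff_exists_inv.mp hu
    refine ha (IsUnit.of_mul_eq_one b ?_)
    have := congrArg Subtype.val hb
    simp only [x, Subring.coe_mul, Subring.coe_one, eq_intCast] at this
    exact_mod_cast this
  obtain ⟨V, -, hV⟩ := Ideal.image_subset_nonunits_valuationSubring (Ideal.span {x}) hx
  exact ⟨V, V.mem_nonunits_iff.mp (hV ⟨x, Ideal.mem_span_singleton_self x, rfl⟩)⟩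

theorem no_common_root_of_valuation {K Γ : Type*} [Field K] [LinearOrderedCommGroupWithZero Γ]
    (v : Valuation K Γ) {a b : K} (ha : v a < 1) (hb : v b = 1) (n : ℕ) {z : K} (hz : z ≠ 0)
    (hP : a * z ^ (n + 3) + b * z ^ (n + 2) + b * z + a = 0)
    (hQ : a * (z - 1) ^ (n + 3) + b * z + a = 0) : False := by
  have hz0 : v z ≠ 0 := v.ne_zero_iff.mpr hz
  have hbz : v (b * z) = v z := by simp [hb]
  rcases le_or_gt (v z) 1 with h | h
  · have hz1 : v (z - 1) ≤ 1 := v.map_sub_le h v.map_one.le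
    have hlt : v z < 1 := by
      have e : b * z = -(a * ((z - 1) ^ (n + 3) + 1)) := by linear_combination hQ
      rw [← hbz, e, v.map_neg, map_mul]
      refine mul_lt_one_of_lt_of_le ha (v.map_add_le ?_ v.map_one.le)
      rw [map_pow]
      exact pow_le_one' hz1 _
    have hp (k : ℕ) : v (z ^ (k + 1)) < 1 := by
      rw [map_pow]; exact pow_lt_one' hlt (by lia)
    have h₁ : v a = v z := by
      have e : a * (1 + z ^ (n + 2 + 1)) = -(b * z * (1 + z ^ (n + 1))) := by
        linear_combination hP
      have e := congrArg v e
      rwa [v.map_neg, map_mul, map_mul, v.map_one_add_of_lt (hp _), v.map_one_add_of_lt (hp _),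
        mul_one, mul_one, hbz] at e
    have h₂ : v a = v z ^ (n + 2) := by
      have e : a * (z ^ (n + 2 + 1) - (z - 1) ^ (n + 3)) = -(b * z ^ (n + 2)) := by
        linear_combination hP - hQ
      have h1 : v ((z - 1) ^ (n + 3)) = 1 := by
        rw [map_pow, v.map_sub_swap, v.map_one_sub_of_lt hlt, one_pow]
      have e := congrArg v e
      rwa [v.map_neg, map_mul, map_mul, v.map_sub_eq_of_lt_right (by rw [h1]; exact hp _), h1,
        hb, mul_one, one_mul, map_pow] at e
    have : v z ^ (n + 1) = 1 := by
      refine mul_right_cancel₀ hz0 ?_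
      rw [one_mul, ← pow_succ, ← h₂, h₁]
    exact (pow_lt_one' hlt (by lia : n + 1 ≠ 0)).ne this
  · have hsum : v (b * z + a) = v z := by
      rw [v.map_add_eq_of_lt_left (by rw [hbz]; exact ha.trans h), hbz]
    have h₁ : v a * v z ^ (n + 2) = 1 := by
      have e : a * (z - 1) ^ (n + 3) = -(b * z + a) := by linear_combination hQ
      have e := congrArg v e
      rw [v.map_neg, hsum, map_mul, map_pow,
        v.map_sub_eq_of_lt_left (by rwa [map_one])] at e
      refine mul_right_cancel₀ hz0 ?_
      rw [one_mul, mul_assoc, ← pow_succ, e]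
    have h₂ : v (a * z + b) * v z ^ (n + 1) = 1 := by
      have e : (a * z + b) * z ^ (n + 2) = -(b * z + a) := by linear_combination hP
      have e := congrArg v e
      rw [v.map_neg, hsum, map_mul, map_pow] at e
      refine mul_right_cancel₀ hz0 ?_
      rw [one_mul, mul_assoc, ← pow_succ, e]
    have hpow : 1 < v z ^ (n + 1) := one_lt_pow₀ h (by lia)
    have h₃ : v (a * z) < 1 := by
      by_contra! hge
      have : 1 ≤ v a * v z := by rwa [← map_mul]
      have : 1 < v a * v z ^ (n + 2) := by
        rw [pow_succ', ← mul_assoc]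
        exact one_lt_mul_of_le_of_lt this hpow
      exact this.ne' h₁
    rw [v.map_add_eq_of_lt_right (by rwa [hb]), hb, one_mul] at h₂
    exact hpow.ne' h₂

theorem no_common_root_of_isCoprime {K : Type*} [Field K] [CharZero K] {a b : ℤ}
    (ha : ¬IsUnit a) (hab : IsCoprime a b) (n : ℕ) {z : K} (hz : z ≠ 0)
    (hP : a * z ^ (n + 3) + b * z ^ (n + 2) + b * z + a = 0)
    (hQ : a * (z - 1) ^ (n + 3) + b * z + a = 0) : False := by
  obtain ⟨V, hV⟩ := exists_valuationSubring_intCast_lt_one (K := K) ha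
  have hint (m : ℤ) : V.valuation (m : K) ≤ 1 :=
    (V.valuation_le_one_iff _).mpr (intCast_mem V m)
  refine no_common_root_of_valuation V.valuation hV ((hint b).antisymm ?_) n hz hP hQ
  by_contra! hb
  obtain ⟨r, s, hrs⟩ := hab
  have e : (r : K) * a + s * b = 1 := by exact_mod_cast hrs
  have : V.valuation ((r : K) * a + s * b) < 1 := by
    refine V.valuation.map_add_lt ?_ ?_ <;> rw [map_mul]
    · exact (mul_le_of_le_one_left' (hint r)).trans_lt hV
    · exact (mul_le_of_le_one_left' (hint s)).trans_lt hb
  rw [e, map_one] at this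
  exact this.false

theorem deriv_goncharFun (n : ℕ) (z : ℂ) :
    deriv (goncharFun (n + 2)) z =
      ((n + 2) * (z - 1) ^ (n + 1) - 1) * z ^ (n + 1) +
        ((z - 1) ^ (n + 2) - z - 1) * ((n + 1) * z ^ n) + (n + 2) * (z - 1) ^ (n + 1) := by
  rw [← eval_derivative_goncharPoly]
  simp [goncharPoly, Polynomial.derivative_pow]

/-- A nonzero multiple zero of the Gonchar polynomial satisfies two sparse equations. -/
theorem sparse_equations_of_double_zero (n : ℕ) {z : ℂ} (hz : z ≠ 0)
    (h : goncharFun (n + 2) z = 0) (h' : deriv (goncharFun (n + 2)) z = 0) :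
    (n + 1) * z ^ (n + 3) + (n + 3) * z ^ (n + 2) + (n + 3) * z + (n + 1) = 0 ∧
    (n + 1) * (z - 1) ^ (n + 3) + (n + 3) * z + (n + 1) = 0 := by
  rw [deriv_goncharFun] at h'
  simp only [goncharFun, show n + 2 - 1 = n + 1 from rfl] at h
  have hw : z ^ (n + 1) ≠ 0 := pow_ne_zero _ hz
  have hQ : (n + 1) * (z - 1) ^ (n + 3) + (n + 3) * z + (n + 1) = 0 := by
    refine mul_left_cancel₀ hw ?_
    linear_combination z * (z - 1) * h' - (n + 2) * z * h
  refine ⟨?_, hQ⟩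
  linear_combination (z ^ (n + 1) + 1) * hQ - (n + 1) * (z - 1) * h

theorem deriv_goncharFun_ne_zero (n : ℕ) {z : ℂ} (h : goncharFun (n + 2) z = 0) :
    deriv (goncharFun (n + 2)) z ≠ 0 := by
  intro h'
  have hz : z ≠ 0 := by
    rintro rfl
    simp [goncharFun] at h
  obtain ⟨hP, hQ⟩ := sparse_equations_of_double_zero n hz h h'
  obtain ⟨k, rfl | rfl⟩ := n.even_or_odd'
  · rcases k with _ | k
    · have h₁ : (z + 1) ^ 3 = 0 := by push_cast at hP; linear_combination hP
      obtain rfl : z = -1 := eq_neg_of_add_eq_zero_left (pow_eq_zero_iff three_ne_zero |>.mp h₁)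
      norm_num at hQ
    · refine no_common_root_of_isCoprime (a := 2 * k + 3) (b := 2 * k + 5) (by
        rw [Int.isUnit_iff]; lia) ⟨k + 2, -(k + 1), by ring⟩ (2 * (k + 1)) hz ?_ ?_
      · push_cast at hP ⊢; linear_combination hP
      · push_cast at hQ ⊢; linear_combination hQ
  · rcases k with _ | k
    · push_cast at hP hQ
      have h₁ : 14 * z ^ 2 + z + 9 = 0 := by
        linear_combination 3 * hP - (z + 3) / 2 * (hP - hQ)
      have h₂ : 59 * z + 307 = 0 := by
        linear_combination 45 * h₁ + 14 * (7 / 2 * (hP - hQ) - 3 * z * h₁)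
      obtain rfl : z = -307 / 59 := by linear_combination h₂ / 59
      norm_num at h₁
    · refine no_common_root_of_isCoprime (a := k + 2) (b := k + 3) (by
        rw [Int.isUnit_iff]; lia) ⟨-1, 1, by ring⟩ (2 * (k + 1) + 1) hz ?_ ?_
      · push_cast at hP ⊢; linear_combination hP / 2
      · push_cast at hQ ⊢; linear_combination hQ / 2

theorem ncard_zeros_goncharFun (n : ℕ) :
    {z : ℂ | goncharFun (n + 2) z = 0}.ncard = 2 * n + 3 := by
  have hp : goncharPoly (n + 2) ≠ 0 := by
    intro h
    simpa [h] using natDegree_goncharPoly n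
  have hnodup : (goncharPoly (n + 2)).roots.Nodup := by
    rw [Multiset.nodup_iff_count_le_one]
    intro z
    rw [Polynomial.count_roots]
    by_contra! h
    rw [Polynomial.one_lt_rootMultiplicity_iff_isRoot hp, Polynomial.IsRoot.def,
      Polynomial.IsRoot.def, eval_goncharPoly, eval_derivative_goncharPoly] at h
    exact deriv_goncharFun_ne_zero n h.1 h.2
  have hset : {z : ℂ | goncharFun (n + 2) z = 0} = (goncharPoly (n + 2)).roots.toFinset := by
    ext z
    simp [hp, eval_goncharPoly]
  rw [hset, Set.ncard_coe_finset, Multiset.toFinset_card_of_nodup hnodup,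
    IsAlgClosed.card_roots_eq_natDegree, natDegree_goncharPoly]

/-- For every `d ≥ 1`, all complex zeros of the Gonchar polynomial
`G(d;z)` are simple; equivalently, `G(d;z)` has `2d−1` distinct complex zeros. -/
theorem gonchar_zeros_simple (d : ℕ) (hd : 1 ≤ d) :
    (∀ ζ : ℂ, goncharFun d ζ = 0 → deriv (goncharFun d) ζ ≠ 0) ∧
    {z : ℂ | goncharFun d z = 0}.ncard = 2 * d - 1 := by
  rcases d with _ | _ | n
  · lia
  · have h : goncharFun 1 = fun z => z - 3 := by
      funext z
      simp only [goncharFun]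
      ring
    have hset : {z : ℂ | z - 3 = 0} = {3} := by
      ext z
      simp [sub_eq_zero]
    simp [h, hset]
  · exact ⟨fun ζ h => deriv_goncharFun_ne_zero n h, by rw [ncard_zeros_goncharFun]; lia⟩
end

section
/- Let d ≥ 1 and let ζ ∈ ℂ be any zero of the Gonchar polynomial G(d;z) = [(z−1)^d − z − 1]·z^{d−1} + (z−1)^d. Then ζ(ζ−1)·G'(d;ζ) = (d−1)(ζ−1)^d(ζ^d + 1) + 2ζ^d, where G'(d;·) denotes the derivative of G(d;·) with respect to z. -/
/-- If `ζ` is any zero of `G(d;z)` (`d ≥ 1`), then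
`ζ(ζ−1)·G'(d;ζ) = (d−1)(ζ−1)^d(ζ^d + 1) + 2ζ^d`. -/
theorem gonchar_derivative_at_zero (d : ℕ) (hd : 1 ≤ d) (ζ : ℂ)
    (hζ : goncharFun d ζ = 0) :
    ζ * (ζ - 1) * deriv (goncharFun d) ζ
      = ((d : ℂ) - 1) * (ζ - 1) ^ d * (ζ ^ d + 1) + 2 * ζ ^ d := by
  obtain ⟨n, rfl⟩ : ∃ n, d = n + 1 := ⟨d - 1, by omega⟩
  have hpow : ζ * ((n : ℂ) * ζ ^ (n - 1)) = n * ζ ^ n := by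
    cases n with
    | zero => simp
    | succ k => rw [Nat.add_sub_cancel, pow_succ]; ring
  have hshift : HasDerivAt (fun z : ℂ => (z - 1) ^ (n + 1)) ((n + 1) * (ζ - 1) ^ n) ζ := by
    simpa using ((hasDerivAt_id ζ).sub_const 1).fun_pow (n + 1)
  have hderiv : HasDerivAt (goncharFun (n + 1))
      (((n + 1) * (ζ - 1) ^ n - 1) * ζ ^ n
        + ((ζ - 1) ^ (n + 1) - ζ - 1) * (n * ζ ^ (n - 1)) + (n + 1) * (ζ - 1) ^ n) ζ :=
    (((hshift.sub (hasDerivAt_id ζ)).sub_const 1).mul (hasDerivAt_pow n ζ)).add hshift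
  rw [hderiv.deriv]
  simp only [goncharFun, Nat.add_sub_cancel] at hζ
  push_cast
  linear_combination (ζ - 1) * ((ζ - 1) ^ (n + 1) - ζ - 1) * hpow
    + (ζ * (n + 1) - n) * hζ
end
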